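/- Construction and minimality of the Green function via exhaustion: Let b be a connected graph over the infinite set X and q : X → ℝ a potential such that h ≥ 0. Let (K_n) be an exhaustion of X (finite sets with K_n ⊆ K_{n+1} and ∪_n K_n = X) and let x ∈ K_1. For each n let g_n be the unique function supported in K_n with Hg_n = 1_{{x}} on K_n (it exists and is unique). Then g_n ≥ 0 for all n and the sequence (g_n) is pointwise nondecreasing. Moreover, if there exists a positive u ∈ F(X) with Hu ≥ 1_{{x}} on X, then g_n ≤ u for all n, the pointwise limit g := lim_n g_n is finite, belongs to F(X), satisfies Hg = 1_{{x}} on X, and g ≤ v for every positive v ∈ F(X) with Hv ≥ 1_{{x}} on X; that is, g is the smallest positive solution of the inequality Hv ≥ 1_{{x}}. -/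

import Mathlib

open Filter Topology

variable {X : Type*}

/-- A graph over `X`: symmetric, nonnegative, zero diagonal, locally summable. -/
def IsGraph (b : X → X → ℝ) : Prop :=
  (∀ x y, 0 ≤ b x y) ∧ (∀ x y, b x y = b y x) ∧ (∀ x, b x x = 0) ∧
    ∀ x, Summable fun y => b x y

/-- Connectedness of the graph `b`: any two vertices are joined by a path of
adjacent vertices. -/
def GraphConnected (b : X → X → ℝ) : Prop :=
  ∀ x y : X, ∃ (n : ℕ) (p : ℕ → X), p 0 = x ∧ p n = y ∧ ∀ i < n, 0 < b (p i) (p (i + 1))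

/-- A set `W` is connected in the graph `b` if any two of its points are joined by a
path of adjacent vertices lying in `W`. -/
def ConnectedIn (b : X → X → ℝ) (W : Set X) : Prop :=
  ∀ x ∈ W, ∀ y ∈ W, ∃ (n : ℕ) (p : ℕ → X), p 0 = x ∧ p n = y ∧
    (∀ i ≤ n, p i ∈ W) ∧ ∀ i < n, 0 < b (p i) (p (i + 1))

/-- Local finiteness of the graph `b`. -/
def LocFin (b : X → X → ℝ) : Prop := ∀ x, {y | 0 < b x y}.Finite

/-- Membership in `F(X)`, the functions against which `b` is summable. -/
def MemF (b : X → X → ℝ) (f : X → ℝ) : Prop :=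
  ∀ x, Summable fun y => b x y * |f y|

/-- The formal Schrödinger operator `H = L + q`. -/
noncomputable def Hop (b : X → X → ℝ) (q : X → ℝ) (f : X → ℝ) (x : X) : ℝ :=
  (∑' y, b x y * (f x - f y)) + q x * f x

/-- Membership in `C_c(X)`: finitely supported functions. -/
def FinSupp (φ : X → ℝ) : Prop := (Function.support φ).Finite

/-- The energy form `h` associated with `b` and `q`, evaluated on `C_c(X)`. -/
noncomputable def hform (b : X → X → ℝ) (q : X → ℝ) (φ : X → ℝ) : ℝ :=
  (1 / 2) * (∑' p : X × X, b p.1 p.2 * (φ p.1 - φ p.2) ^ 2) + ∑' x, q x * φ x ^ 2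

/-- The form `h` is subcritical in `X`. -/
def Subcritical (b : X → X → ℝ) (q : X → ℝ) : Prop :=
  ∃ w : X → ℝ, (∀ x, 0 ≤ w x) ∧ w ≠ 0 ∧
    ∀ φ : X → ℝ, FinSupp φ → (∑' x, w x * φ x ^ 2) ≤ hform b q φ

/-- The capacity of the singleton `{x}` with respect to the form `h`. -/
noncomputable def capH (b : X → X → ℝ) (q : X → ℝ) (x : X) : ℝ :=
  sInf {r : ℝ | ∃ φ : X → ℝ, FinSupp φ ∧ φ x = 1 ∧ r = hform b q φ}

/-- The extended (extended-real-valued) energy of the weighted Laplacian part. -/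
noncomputable def hExt (b : X → X → ℝ) (f : X → ℝ) : ENNReal :=
  (∑' p : X × X, ENNReal.ofReal (b p.1 p.2 * (f p.1 - f p.2) ^ 2)) / 2

theorem MemF.summable {b : X → X → ℝ} (hb : IsGraph b) {f : X → ℝ} (hf : MemF b f) (y : X) :
    Summable fun z => b y z * f z := by
  refine Summable.of_norm ((hf y).congr fun z => ?_)
  rw [Real.norm_eq_abs, abs_mul, abs_of_nonneg (hb.1 y z)]

theorem MemF.of_support {b : X → X → ℝ} {f : X → ℝ} {K : Finset X}
    (hf : ∀ y, f y ≠ 0 → y ∈ K) : MemF b f := by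
  refine fun y => summable_of_ne_finset_zero (s := K) fun z hz => ?_
  rw [not_imp_comm.1 (hf z) hz, abs_zero, mul_zero]

theorem MemF.sub {b : X → X → ℝ} (hb : IsGraph b) {f g : X → ℝ} (hf : MemF b f)
    (hg : MemF b g) : MemF b (f - g) := by
  refine fun y => Summable.of_nonneg_of_le (fun z => mul_nonneg (hb.1 y z) (abs_nonneg _))
    (fun z => ?_) ((hf y).add (hg y))
  rw [← mul_add]
  exact mul_le_mul_of_nonneg_left (abs_sub _ _) (hb.1 y z)

/-- On `F(X)` the operator splits into its diagonal and off-diagonal parts. -/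
theorem Hop_eq {b : X → X → ℝ} (hb : IsGraph b) (q : X → ℝ) {f : X → ℝ} (hf : MemF b f)
    (y : X) :
    Hop b q f y = ((∑' z, b y z) + q y) * f y - ∑' z, b y z * f z := by
  have h : ∑' z, b y z * (f y - f z) = (∑' z, b y z) * f y - ∑' z, b y z * f z := by
    simp_rw [mul_sub]
    rw [((hb.2.2.2 y).mul_right _).tsum_sub (hf.summable hb y), tsum_mul_right]
  rw [Hop, h]
  ring

theorem Hop_sub {b : X → X → ℝ} (hb : IsGraph b) (q : X → ℝ) {f g : X → ℝ} (hf : MemF b f)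
    (hg : MemF b g) (y : X) :
    Hop b q (f - g) y = Hop b q f y - Hop b q g y := by
  have h : ∑' z, b y z * (f - g) z = ∑' z, b y z * f z - ∑' z, b y z * g z := by
    rw [← (hf.summable hb y).tsum_sub (hg.summable hb y)]
    simp [mul_sub]
  rw [Hop_eq hb q hf, Hop_eq hb q hg, Hop_eq hb q (hf.sub hb hg), h, Pi.sub_apply]
  ring

theorem Hop_eq_of_support {b : X → X → ℝ} (hb : IsGraph b) (q : X → ℝ) {f : X → ℝ}
    {K : Finset X} (hf : ∀ y, f y ≠ 0 → y ∈ K) (y : X) :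
    Hop b q f y = ((∑' z, b y z) + q y) * f y - ∑ z ∈ K, b y z * f z := by
  rw [Hop_eq hb q (MemF.of_support hf), tsum_eq_sum (f := fun z => b y z * f z) fun z hz => ?_]
  rw [not_imp_comm.1 (hf z) hz, mul_zero]

/-- Green's formula for finitely supported functions. -/
theorem hform_eq_sum_mul_Hop {b : X → X → ℝ} (hb : IsGraph b) (q : X → ℝ) {f : X → ℝ}
    {K : Finset X} (hf : ∀ y, f y ≠ 0 → y ∈ K) :
    hform b q f = ∑ y ∈ K, f y * Hop b q f y := by
  have hf0 : ∀ y ∉ K, f y = 0 := fun y hy => not_imp_comm.1 (hf y) hy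
  have hdiag : Summable fun p : X × X => b p.1 p.2 * f p.1 ^ 2 := by
    refine (summable_prod_of_nonneg fun p => mul_nonneg (hb.1 _ _) (sq_nonneg _)).2
      ⟨fun y => (hb.2.2.2 y).mul_right (f y ^ 2),
        summable_of_ne_finset_zero (s := K) fun y hy => ?_⟩
    simp [hf0 y hy]
  have hdiag_tsum : ∑' p : X × X, b p.1 p.2 * f p.1 ^ 2 = ∑ y ∈ K, (∑' z, b y z) * f y ^ 2 := by
    rw [hdiag.tsum_prod, tsum_eq_sum (s := K) fun y hy => ?_]
    · simp_rw [tsum_mul_right]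
    · simp [hf0 y hy]
  have hswap (p : X × X) : b p.1 p.2 * f p.2 ^ 2 = b p.swap.1 p.swap.2 * f p.swap.1 ^ 2 := by
    rw [hb.2.1 p.1 p.2]
    rfl
  have hdiag' : Summable fun p : X × X => b p.1 p.2 * f p.2 ^ 2 := by
    simp_rw [hswap]
    exact (Equiv.prodComm X X).summable_iff.2 hdiag
  have hdiag'_tsum : ∑' p : X × X, b p.1 p.2 * f p.2 ^ 2 = ∑ y ∈ K, (∑' z, b y z) * f y ^ 2 := by
    rw [← hdiag_tsum]
    simp_rw [hswap]
    exact (Equiv.prodComm X X).tsum_eq fun p : X × X => b p.1 p.2 * f p.1 ^ 2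
  have hoff (p : X × X) (hp : p ∉ K ×ˢ K) : 2 * (b p.1 p.2 * f p.1 * f p.2) = 0 := by
    rw [Finset.mem_product, not_and_or] at hp
    rcases hp with hp | hp <;> simp [hf0 _ hp]
  have hexpand (p : X × X) : b p.1 p.2 * (f p.1 - f p.2) ^ 2 =
      b p.1 p.2 * f p.1 ^ 2 + b p.1 p.2 * f p.2 ^ 2 - 2 * (b p.1 p.2 * f p.1 * f p.2) := by
    ring
  have hpot : ∑' y, q y * f y ^ 2 = ∑ y ∈ K, q y * f y ^ 2 :=
    tsum_eq_sum fun y hy => by simp [hf0 y hy]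
  rw [hform, hpot]
  simp_rw [hexpand]
  rw [(hdiag.add hdiag').tsum_sub (summable_of_ne_finset_zero hoff), hdiag.tsum_add hdiag',
    hdiag_tsum, hdiag'_tsum, tsum_eq_sum hoff, Finset.sum_product, ← two_mul]
  simp_rw [← Finset.mul_sum]
  rw [← mul_sub, ← mul_assoc, one_div_mul_cancel two_ne_zero, one_mul, ← Finset.sum_sub_distrib,
    ← Finset.sum_add_distrib]
  refine Finset.sum_congr rfl fun y _ => ?_
  rw [Hop_eq_of_support hb q hf, mul_sub, Finset.mul_sum]
  have : ∑ z ∈ K, b y z * f y * f z = ∑ z ∈ K, f y * (b y z * f z) :=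
    Finset.sum_congr rfl fun z _ => by ring
  rw [this]
  ring

/-- A finitely supported function with vanishing energy is a minimizer of a nonnegative form,
hence harmonic. -/
theorem Hop_eq_zero_of_hform_nonpos {b : X → X → ℝ} (hb : IsGraph b) {q : X → ℝ}
    (hpos : ∀ φ : X → ℝ, FinSupp φ → 0 ≤ hform b q φ) {f : X → ℝ} {K : Finset X}
    (hf : ∀ y, f y ≠ 0 → y ∈ K) (h0 : hform b q f ≤ 0) (x : X) : Hop b q f x = 0 := by
  classical
  set L := insert x K with hL
  have hxL : x ∈ L := Finset.mem_insert_self _ _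
  have hfL : ∀ y, f y ≠ 0 → y ∈ L := fun y hy => Finset.mem_insert_of_mem (hf y hy)
  set δ : X → ℝ := Pi.single x 1 with hδ
  have hδL : ∀ y, δ y ≠ 0 → y ∈ L := by
    intro y hy
    rcases eq_or_ne y x with rfl | h
    · exact hxL
    · simp [hδ, h] at hy
  have hδsum (u : X → ℝ) : ∑ y ∈ L, δ y * u y = u x := by
    simp [hδ, Pi.single_apply, hxL]
  have hsymm : ∑ y ∈ L, f y * Hop b q δ y = Hop b q f x := by
    have hterm (y : X) : f y * Hop b q δ y =
        δ y * (((∑' z, b y z) + q y) * f y) - b x y * f y := by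
      have : ∑ z ∈ L, b y z * δ z = b y x := by
        simp_rw [mul_comm (b y _)]
        exact hδsum _
      rw [Hop_eq_of_support hb q hδL, this, hb.2.1 x y]
      ring
    simp_rw [hterm]
    rw [Finset.sum_sub_distrib, hδsum, Hop_eq_of_support hb q hfL]
  have hquad (t : ℝ) :
      0 ≤ Hop b q δ x * (t * t) + (2 * Hop b q f x) * t + hform b q f := by
    set ψ : X → ℝ := fun y => f y + t * δ y with hψ
    have hψL : ∀ y, ψ y ≠ 0 → y ∈ L := by
      intro y hy
      by_contra h
      exact hy (by simp [hψ, not_imp_comm.1 (hfL y) h, not_imp_comm.1 (hδL y) h])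
    have hHψ (y : X) : Hop b q ψ y = Hop b q f y + t * Hop b q δ y := by
      rw [Hop_eq_of_support hb q hψL, Hop_eq_of_support hb q hfL, Hop_eq_of_support hb q hδL,
        mul_sub, Finset.mul_sum]
      have : ∑ z ∈ L, b y z * ψ z = ∑ z ∈ L, b y z * f z + ∑ z ∈ L, t * (b y z * δ z) := by
        rw [← Finset.sum_add_distrib]
        exact Finset.sum_congr rfl fun z _ => by simp only [hψ]; ring
      rw [this]
      simp only [hψ]
      ring
    have hψ0 := hpos ψ (L.finite_toSet.subset fun y hy => hψL y hy)
    rw [hform_eq_sum_mul_Hop hb q hψL] at hψ0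
    have hterm (y : X) : ψ y * Hop b q ψ y = f y * Hop b q f y + t * (f y * Hop b q δ y) +
        (t * (δ y * Hop b q f y) + t * t * (δ y * Hop b q δ y)) := by
      rw [hHψ]
      simp only [hψ]
      ring
    simp_rw [hterm, Finset.sum_add_distrib, ← Finset.mul_sum, hδsum, hsymm] at hψ0
    rw [hform_eq_sum_mul_Hop hb q hfL]
    linarith
  have hdisc := discrim_le_zero hquad
  have hzero : hform b q f = 0 := le_antisymm h0 (hpos f (K.finite_toSet.subset fun y hy => hf y hy))
  rw [discrim, hzero, mul_zero, sub_zero] at hdisc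
  have := pow_eq_zero_iff two_ne_zero |>.1 (le_antisymm hdisc (sq_nonneg _))
  linarith

/-- A nonnegative finitely supported harmonic function on a connected infinite graph vanishes. -/
theorem eq_zero_of_Hop_eq_zero [Infinite X] {b : X → X → ℝ} (hb : IsGraph b)
    (hconn : GraphConnected b) {q f : X → ℝ} {K : Finset X} (hf : ∀ y, f y ≠ 0 → y ∈ K)
    (hf0 : ∀ y, 0 ≤ f y) (hH : ∀ y, Hop b q f y = 0) (y : X) : f y = 0 := by
  have hstep {y z : X} (hy : f y = 0) (hyz : 0 < b y z) : f z = 0 := by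
    have h := hH y
    rw [Hop_eq_of_support hb q hf, hy, mul_zero, zero_sub, neg_eq_zero,
      Finset.sum_eq_zero_iff_of_nonneg fun w _ => mul_nonneg (hb.1 y w) (hf0 w)] at h
    by_contra hz
    exact hz ((mul_eq_zero.1 (h z (hf z hz))).resolve_left hyz.ne')
  obtain ⟨w, hw⟩ := Infinite.exists_notMem_finset K
  obtain ⟨n, p, hp0, hpn, hp⟩ := hconn w y
  have hpath : ∀ i ≤ n, f (p i) = 0 := by
    intro i
    induction i with
    | zero => exact fun _ => hp0 ▸ not_imp_comm.1 (hf w) hw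
    | succ i ih => exact fun hi => hstep (ih (by omega)) (hp i (by omega))
  exact hpn ▸ hpath n le_rfl

/-- The comparison principle on finite sets. -/
theorem nonneg_of_Hop_nonneg [Infinite X] {b : X → X → ℝ} (hb : IsGraph b)
    (hconn : GraphConnected b) {q : X → ℝ}
    (hpos : ∀ φ : X → ℝ, FinSupp φ → 0 ≤ hform b q φ) {f : X → ℝ} (hf : MemF b f)
    {K : Finset X} (hout : ∀ y ∉ K, 0 ≤ f y) (hin : ∀ y ∈ K, 0 ≤ Hop b q f y) (y : X) :
    0 ≤ f y := by
  have hneg : ∀ y, (f y)⁻ ≠ 0 → y ∈ K := fun y hy => by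
    by_contra h
    exact hy (negPart_eq_zero.2 (hout y h))
  have hnegF : MemF b fun y => (f y)⁻ := MemF.of_support hneg
  have hposF : MemF b fun y => (f y)⁺ := fun z =>
    Summable.of_nonneg_of_le (fun w => mul_nonneg (hb.1 z w) (abs_nonneg _))
      (fun w => mul_le_mul_of_nonneg_left
        (by rw [abs_of_nonneg (posPart_nonneg _)]; exact sup_le (le_abs_self _) (abs_nonneg _))
        (hb.1 z w)) (hf z)
  have henergy : hform b q (fun y => (f y)⁻) ≤ 0 := by
    rw [hform_eq_sum_mul_Hop hb q hneg]
    refine Finset.sum_nonpos fun z hz => ?_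
    rcases le_or_gt 0 (f z) with h | h
    · simp [negPart_eq_zero.2 h]
    refine mul_nonpos_of_nonneg_of_nonpos (negPart_nonneg _) ?_
    have hsplit : f = (fun y => (f y)⁺) - fun y => (f y)⁻ := by
      funext w
      simp [posPart_sub_negPart]
    have hHf := hin z hz
    rw [hsplit, Hop_sub hb q hposF hnegF, Hop_eq hb q hposF, posPart_eq_zero.2 h.le] at hHf
    have : 0 ≤ ∑' w, b z w * (f w)⁺ :=
      tsum_nonneg fun w => mul_nonneg (hb.1 z w) (posPart_nonneg _)
    linarith
  exact negPart_eq_zero.1 (eq_zero_of_Hop_eq_zero hb hconn hneg (fun _ => negPart_nonneg _)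
    (Hop_eq_zero_of_hform_nonpos hb hpos hneg henergy) y)

theorem le_of_Hop_le [Infinite X] {b : X → X → ℝ} (hb : IsGraph b)
    (hconn : GraphConnected b) {q : X → ℝ}
    (hpos : ∀ φ : X → ℝ, FinSupp φ → 0 ≤ hform b q φ) {f g : X → ℝ} (hf : MemF b f)
    (hg : MemF b g) {K : Finset X} (hout : ∀ y ∉ K, f y ≤ g y)
    (hin : ∀ y ∈ K, Hop b q f y ≤ Hop b q g y) (y : X) : f y ≤ g y := by
  refine sub_nonneg.1 (nonneg_of_Hop_nonneg hb hconn hpos (hg.sub hb hf) (K := K)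
    (fun z hz => sub_nonneg.2 (hout z hz)) (fun z hz => ?_) y)
  rw [Hop_sub hb q hg hf]
  exact sub_nonneg.2 (hin z hz)

/-- Dominated convergence for the formal Schrödinger operator. -/
theorem tendsto_Hop {b : X → X → ℝ} (hb : IsGraph b) (q : X → ℝ) {g : ℕ → X → ℝ} {G u : X → ℝ}
    (hu : MemF b u) (hgu : ∀ n y, |g n y| ≤ u y)
    (hG : ∀ y, Tendsto (fun n => g n y) atTop (𝓝 (G y))) (y : X) :
    Tendsto (fun n => Hop b q (g n) y) atTop (𝓝 (Hop b q G y)) := by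
  refine Tendsto.add ?_ ((hG y).const_mul _)
  refine tendsto_tsum_of_dominated_convergence
    (((hb.2.2.2 y).mul_right (u y)).add (hu.summable hb y))
    (fun z => ((hG y).sub (hG z)).const_mul _) (Eventually.of_forall fun n z => ?_)
  rw [Real.norm_eq_abs, abs_mul, abs_of_nonneg (hb.1 y z), ← mul_add]
  exact mul_le_mul_of_nonneg_left
    ((abs_sub _ _).trans (add_le_add (hgu n y) (hgu n z))) (hb.1 y z)

open scoped Classical in
/-- Construction and minimality of the Green function via exhaustion. -/
theorem green_function_exhaustion (b : X → X → ℝ) (q : X → ℝ)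
    (hX : Infinite X) (hb : IsGraph b) (hconn : GraphConnected b)
    (hpos : ∀ φ : X → ℝ, FinSupp φ → 0 ≤ hform b q φ)
    (K : ℕ → Finset X) (hKmono : ∀ n, K n ⊆ K (n + 1)) (hKex : ∀ y : X, ∃ n, y ∈ K n)
    (x : X) (hx : x ∈ K 0)
    (g : ℕ → X → ℝ)
    (hgsupp : ∀ n, ∀ y : X, g n y ≠ 0 → y ∈ K n)
    (hgeq : ∀ n, ∀ y ∈ K n, Hop b q (g n) y = (if y = x then (1 : ℝ) else 0)) :
    (∀ n, ∃! g' : X → ℝ, (∀ y : X, g' y ≠ 0 → y ∈ K n) ∧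
        ∀ y ∈ K n, Hop b q g' y = (if y = x then (1 : ℝ) else 0)) ∧
    (∀ n y, 0 ≤ g n y) ∧
    (∀ n y, g n y ≤ g (n + 1) y) ∧
    (∀ u : X → ℝ, MemF b u → (∀ y, 0 ≤ u y) → u ≠ 0 →
      (∀ y, (if y = x then (1 : ℝ) else 0) ≤ Hop b q u y) → ∀ n y, g n y ≤ u y) ∧
    ((∃ u : X → ℝ, MemF b u ∧ (∀ y, 0 ≤ u y) ∧ u ≠ 0 ∧
        ∀ y, (if y = x then (1 : ℝ) else 0) ≤ Hop b q u y) →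
      ∃ G : X → ℝ, (∀ y, Tendsto (fun n => g n y) atTop (nhds (G y))) ∧
        MemF b G ∧ (∀ y, 0 ≤ G y) ∧ G ≠ 0 ∧
        (∀ y, Hop b q G y = (if y = x then (1 : ℝ) else 0)) ∧
        ∀ v : X → ℝ, MemF b v → (∀ y, 0 ≤ v y) → v ≠ 0 →
          (∀ y, (if y = x then (1 : ℝ) else 0) ≤ Hop b q v y) → ∀ y, G y ≤ v y) := by
  have hgF (n : ℕ) : MemF b (g n) := MemF.of_support (hgsupp n)
  have hg0 (n : ℕ) : ∀ y ∉ K n, g n y = 0 := fun y hy => not_imp_comm.1 (hgsupp n y) hy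
  have hnonneg (n : ℕ) (y : X) : 0 ≤ g n y := by
    refine nonneg_of_Hop_nonneg hb hconn hpos (hgF n) (fun z hz => (hg0 n z hz).ge)
      (fun z hz => ?_) y
    rw [hgeq n z hz]
    split_ifs <;> norm_num
  have hmono (n : ℕ) (y : X) : g n y ≤ g (n + 1) y := by
    refine le_of_Hop_le hb hconn hpos (hgF n) (hgF (n + 1)) (K := K n)
      (fun z hz => (hg0 n z hz).trans_le (hnonneg _ z)) (fun z hz => ?_) y
    rw [hgeq n z hz, hgeq (n + 1) z (hKmono n hz)]
  have hle (u : X → ℝ) (hu : MemF b u) (hu0 : ∀ y, 0 ≤ u y)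
      (hHu : ∀ y, (if y = x then (1 : ℝ) else 0) ≤ Hop b q u y) (n : ℕ) (y : X) :
      g n y ≤ u y :=
    le_of_Hop_le hb hconn hpos (hgF n) hu (fun z hz => (hg0 n z hz).trans_le (hu0 z))
      (fun z hz => (hgeq n z hz).trans_le (hHu z)) y
  refine ⟨fun n => ⟨g n, ⟨hgsupp n, hgeq n⟩, ?_⟩, hnonneg, hmono,
    fun u hu hu0 _ hHu => hle u hu hu0 hHu, ?_⟩
  · rintro g' ⟨hs, he⟩
    have hs0 : ∀ y ∉ K n, g' y = 0 := fun y hy => not_imp_comm.1 (hs y) hy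
    have hF : MemF b g' := MemF.of_support hs
    funext y
    exact le_antisymm
      (le_of_Hop_le hb hconn hpos hF (hgF n) (fun z hz => by rw [hs0 z hz, hg0 n z hz])
        (fun z hz => by rw [he z hz, hgeq n z hz]) y)
      (le_of_Hop_le hb hconn hpos (hgF n) hF (fun z hz => by rw [hs0 z hz, hg0 n z hz])
        (fun z hz => by rw [he z hz, hgeq n z hz]) y)
  rintro ⟨u, hu, hu0, -, hHu⟩
  have hgu := hle u hu hu0 hHu
  have hgmono (y : X) : Monotone fun n => g n y := monotone_nat_of_le_succ fun n => hmono n y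
  have hG (y : X) : Tendsto (fun n => g n y) atTop (𝓝 (⨆ n, g n y)) :=
    tendsto_atTop_ciSup (hgmono y) ⟨u y, Set.forall_mem_range.2 fun n => hgu n y⟩
  have hG0 (y : X) : 0 ≤ ⨆ n, g n y := ge_of_tendsto' (hG y) fun n => hnonneg n y
  have hHG (y : X) : Hop b q (fun y => ⨆ n, g n y) y = if y = x then (1 : ℝ) else 0 := by
    refine tendsto_nhds_unique (tendsto_Hop hb q hu
      (fun n z => by rw [abs_of_nonneg (hnonneg n z)]; exact hgu n z) hG y)
      (tendsto_const_nhds.congr' ?_)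
    obtain ⟨N, hN⟩ := hKex y
    filter_upwards [eventually_ge_atTop N] with n hn
    exact (hgeq n y (monotone_nat_of_le_succ hKmono hn hN)).symm
  refine ⟨fun y => ⨆ n, g n y, hG, fun y => ?_, hG0, fun h => ?_, hHG,
    fun v hv hv0 _ hHv y => le_of_tendsto' (hG y) fun n => hle v hv hv0 hHv n y⟩
  · refine Summable.of_nonneg_of_le (fun z => mul_nonneg (hb.1 y z) (abs_nonneg _)) (fun z => ?_)
      (hu.summable hb y)
    rw [abs_of_nonneg (hG0 z)]
    exact mul_le_mul_of_nonneg_left (le_of_tendsto' (hG z) fun n => hgu n z) (hb.1 y z)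
  · have := hHG x
    rw [h] at this
    simp [Hop] at this
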